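/- Variance comparison between Wasserstein and linear barycenters: for Ω a probability measure on P(K), K ⊂ ℝⁿ compact convex, with W₂-barycenter μ̄ and linear barycenter BC^L(Ω) defined by BC^L(Ω)(A) = ∫ μ(A) dΩ(μ), one has Var(μ̄) ≤ Var(BC^L(Ω)). -/

import Mathlib

open MeasureTheory Set Filter

/-- The variance of a measure on a metric space: the infimal second moment. -/
noncomputable def var {M : Type*} [MetricSpace M] [MeasurableSpace M] (mu : Measure M) : ℝ :=
  ⨅ y : M, ∫ x, dist x y ^ 2 ∂mu

/-- The squared 2-Wasserstein distance, as the infimal quadratic transport cost over couplings. -/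
noncomputable def W2sq {M : Type*} [MetricSpace M] [MeasurableSpace M] (mu nu : Measure M) : ℝ :=
  sInf ((fun gamma : Measure (M × M) => ∫ p, dist p.1 p.2 ^ 2 ∂gamma) ''
    {gamma | gamma.map Prod.fst = mu ∧ gamma.map Prod.snd = nu})

open scoped Topology

lemma isProbabilityMeasure_of_map_fst {X Y : Type*} [MeasurableSpace X] [MeasurableSpace Y]
    {γ : Measure (X × Y)} {μ : Measure X} [IsProbabilityMeasure μ] (h : γ.map Prod.fst = μ) :
    IsProbabilityMeasure γ := by
  constructor
  rw [← measure_univ (μ := μ), ← h, Measure.map_apply measurable_fst MeasurableSet.univ,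
    preimage_univ]

lemma Continuous.integrable_of_compactSpace {Y : Type*} [TopologicalSpace Y] [CompactSpace Y]
    [MeasurableSpace Y] [OpensMeasurableSpace Y] {f : Y → ℝ} (hf : Continuous f)
    (μ : Measure Y) [IsFiniteMeasure μ] : Integrable f μ :=
  hf.integrable_of_hasCompactSupport (HasCompactSupport.of_compactSpace f)

lemma integral_linearCombination {Y : Type*} [MeasurableSpace Y] {μ : Measure Y} {f g h : Y → ℝ}
    (hf : Integrable f μ) (hg : Integrable g μ) (hh : Integrable h μ) (a b c : ℝ) :
    ∫ x, (a * f x + b * g x - c * h x) ∂μ =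
      a * ∫ x, f x ∂μ + b * ∫ x, g x ∂μ - c * ∫ x, h x ∂μ := by
  rw [integral_sub (f := fun x => a * f x + b * g x) ((hf.const_mul a).add (hg.const_mul b))
    (hh.const_mul c), integral_add (hf.const_mul a) (hg.const_mul b), integral_const_mul,
    integral_const_mul, integral_const_mul]

lemma measurable_probabilityMeasure_toMeasure {X : Type*} [MetricSpace X] [MeasurableSpace X]
    [BorelSpace X] [MeasurableSpace (ProbabilityMeasure X)] [BorelSpace (ProbabilityMeasure X)] :
    Measurable fun μ : ProbabilityMeasure X => (μ : Measure X) := by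
  refine Measurable.measure_of_isPiSystem_of_isProbabilityMeasure
    (BorelSpace.measurable_eq (α := X)) isPiSystem_isOpen fun G hG => ?_
  refine LowerSemicontinuous.measurable (lowerSemicontinuous_iff_le_liminf.2 fun μ => ?_)
  exact ProbabilityMeasure.le_liminf_measure_open_of_tendsto tendsto_id hG

section CompactMetric

variable {X : Type*} [MetricSpace X] [MeasurableSpace X]

/-- The quadratic transport cost of a plan. -/
noncomputable def transportCost (γ : Measure (X × X)) : ℝ := ∫ p, dist p.1 p.2 ^ 2 ∂γ

lemma transportCost_nonneg (γ : Measure (X × X)) : 0 ≤ transportCost γ :=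
  integral_nonneg fun _ => sq_nonneg _

lemma bddBelow_transportCost (s : Set (Measure (X × X))) :
    BddBelow (transportCost '' s) :=
  ⟨0, by rintro _ ⟨γ, -, rfl⟩; exact transportCost_nonneg γ⟩

lemma nonempty_transportCost (μ ν : Measure X) [IsProbabilityMeasure μ] [IsProbabilityMeasure ν] :
    (transportCost '' {γ | γ.map Prod.fst = μ ∧ γ.map Prod.snd = ν}).Nonempty :=
  ⟨_, μ.prod ν, ⟨by simp, by simp⟩, rfl⟩

lemma W2sq_nonneg (μ ν : Measure X) : 0 ≤ W2sq μ ν :=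
  Real.sInf_nonneg (by rintro _ ⟨γ, -, rfl⟩; exact transportCost_nonneg γ)

lemma W2sq_le {μ ν : Measure X} {γ : Measure (X × X)} (h₁ : γ.map Prod.fst = μ)
    (h₂ : γ.map Prod.snd = ν) : W2sq μ ν ≤ transportCost γ :=
  csInf_le (bddBelow_transportCost _) ⟨γ, ⟨h₁, h₂⟩, rfl⟩

lemma exists_transportCost_lt {μ ν : Measure X} [IsProbabilityMeasure μ] [IsProbabilityMeasure ν]
    {c : ℝ} (h : W2sq μ ν < c) :
    ∃ γ : Measure (X × X), (γ.map Prod.fst = μ ∧ γ.map Prod.snd = ν) ∧ transportCost γ < c := by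
  obtain ⟨_, ⟨γ, hγ, rfl⟩, hlt⟩ := exists_lt_of_csInf_lt (nonempty_transportCost μ ν) h
  exact ⟨γ, hγ, hlt⟩

variable [CompactSpace X] [BorelSpace X]

lemma W2sq_le_diam_sq (μ ν : Measure X) [IsProbabilityMeasure μ] [IsProbabilityMeasure ν] :
    W2sq μ ν ≤ Metric.diam (univ : Set X) ^ 2 := by
  refine (W2sq_le (γ := μ.prod ν) (by simp) (by simp)).trans ?_
  have hc : Continuous fun p : X × X => dist p.1 p.2 ^ 2 := by fun_prop
  refine (integral_mono (hc.integrable_of_compactSpace _)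
    (integrable_const (Metric.diam (univ : Set X) ^ 2)) fun p => ?_).trans (by simp)
  exact pow_le_pow_left₀ dist_nonneg
    (Metric.dist_le_diam_of_mem isCompact_univ.isBounded (mem_univ _) (mem_univ _)) 2

/-- The sublevel sets of the transport cost project to compact sets of first marginals. -/
lemma isClosed_exists_transportCost_le (ν : ProbabilityMeasure X) (c : ℝ) :
    IsClosed {μ : ProbabilityMeasure X | ∃ γ : ProbabilityMeasure (X × X),
      γ.map continuous_fst.measurable.aemeasurable = μ ∧
      γ.map continuous_snd.measurable.aemeasurable = ν ∧
      transportCost (γ : Measure (X × X)) ≤ c} := by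
  have hfst : Continuous fun γ : ProbabilityMeasure (X × X) =>
      γ.map continuous_fst.measurable.aemeasurable :=
    ProbabilityMeasure.continuous_map continuous_fst
  have hsnd : Continuous fun γ : ProbabilityMeasure (X × X) =>
      γ.map continuous_snd.measurable.aemeasurable :=
    ProbabilityMeasure.continuous_map continuous_snd
  have hcost : Continuous fun γ : ProbabilityMeasure (X × X) =>
      transportCost (γ : Measure (X × X)) :=
    have hd : Continuous fun p : X × X => dist p.1 p.2 ^ 2 := by fun_prop
    ProbabilityMeasure.continuous_integral_continuousMap (⟨_, hd⟩ : C(X × X, ℝ))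
  have hK : IsCompact {γ : ProbabilityMeasure (X × X) |
      γ.map continuous_snd.measurable.aemeasurable = ν ∧
      transportCost (γ : Measure (X × X)) ≤ c} :=
    ((isClosed_eq hsnd continuous_const).inter
      (isClosed_le hcost continuous_const)).isCompact
  convert (hK.image hfst).isClosed using 1
  ext μ
  simp only [mem_ofPred_eq, mem_image]
  exact ⟨fun ⟨γ, h₁, h₂⟩ => ⟨γ, h₂, h₁⟩, fun ⟨γ, h₂, h₁⟩ => ⟨γ, h₁, h₂⟩⟩

variable [MeasurableSpace (ProbabilityMeasure X)] [BorelSpace (ProbabilityMeasure X)]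

lemma measurable_W2sq (ν : ProbabilityMeasure X) :
    Measurable fun μ : ProbabilityMeasure X => W2sq (μ : Measure X) (ν : Measure X) := by
  refine measurable_of_Iio fun c => ?_
  have : (fun μ : ProbabilityMeasure X => W2sq (μ : Measure X) (ν : Measure X)) ⁻¹' Iio c =
      ⋃ q : {q : ℚ // (q : ℝ) < c}, {μ : ProbabilityMeasure X |
        ∃ γ : ProbabilityMeasure (X × X),
          γ.map continuous_fst.measurable.aemeasurable = μ ∧
          γ.map continuous_snd.measurable.aemeasurable = ν ∧
          transportCost (γ : Measure (X × X)) ≤ ((q : ℚ) : ℝ)} := by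
    ext μ
    simp only [mem_preimage, mem_Iio, mem_iUnion, mem_ofPred_eq]
    constructor
    · intro h
      obtain ⟨γ, ⟨h₁, h₂⟩, hlt⟩ := exists_transportCost_lt h
      obtain ⟨q, hq₁, hq₂⟩ := exists_rat_btwn hlt
      have : IsProbabilityMeasure γ := isProbabilityMeasure_of_map_fst h₁
      exact ⟨⟨q, hq₂⟩, ⟨γ, this⟩, Subtype.ext h₁, Subtype.ext h₂, hq₁.le⟩
    · rintro ⟨⟨q, hq⟩, γ, h₁, h₂, hle⟩
      exact (W2sq_le (congrArg Subtype.val h₁) (congrArg Subtype.val h₂)).trans_lt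
        (hle.trans_lt hq)
  rw [this]
  exact MeasurableSet.iUnion fun q => (isClosed_exists_transportCost_le ν _).measurableSet

lemma integrable_W2sq (Ω : Measure (ProbabilityMeasure X)) [IsProbabilityMeasure Ω]
    (ν : ProbabilityMeasure X) :
    Integrable (fun μ : ProbabilityMeasure X => W2sq (μ : Measure X) (ν : Measure X)) Ω :=
  Integrable.of_mem_Icc 0 (Metric.diam (univ : Set X) ^ 2) (measurable_W2sq ν).aemeasurable
    (ae_of_all _ fun _ => ⟨W2sq_nonneg _ _, W2sq_le_diam_sq _ _⟩)

/-- Integration against the linear barycenter of a nonnegative continuous function. -/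
lemma integral_eq_integral_integral_of_mixture (Ω : Measure (ProbabilityMeasure X))
    [IsProbabilityMeasure Ω] (νL : Measure X)
    (hνL : ∀ A : Set X, MeasurableSet A → νL A = ∫⁻ μ, (μ : Measure X) A ∂Ω)
    {f : X → ℝ} (hf : Continuous f) (hf0 : ∀ x, 0 ≤ f x) :
    ∫ x, f x ∂νL = ∫ μ, ∫ x, f x ∂(μ : Measure X) ∂Ω := by
  have hm := measurable_probabilityMeasure_toMeasure (X := X)
  have hbind : νL = Ω.bind fun μ : ProbabilityMeasure X => (μ : Measure X) :=
    Measure.ext fun A hA => by rw [hνL A hA, Measure.bind_apply hA hm.aemeasurable]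
  have hcont : Continuous fun μ : ProbabilityMeasure X => ∫ x, f x ∂(μ : Measure X) :=
    ProbabilityMeasure.continuous_integral_continuousMap (⟨f, hf⟩ : C(X, ℝ))
  rw [integral_eq_lintegral_of_nonneg_ae (ae_of_all _ hf0) hf.aestronglyMeasurable, hbind,
    Measure.lintegral_bind hm.aemeasurable hf.measurable.ennreal_ofReal.aemeasurable,
    integral_eq_lintegral_of_nonneg_ae (ae_of_all _ fun μ => integral_nonneg hf0)
      hcont.measurable.aestronglyMeasurable]
  congr 1
  refine lintegral_congr fun μ => ?_
  rw [ofReal_integral_eq_lintegral_ofReal (hf.integrable_of_compactSpace _) (ae_of_all _ hf0)]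

end CompactMetric

lemma norm_sub_convexCombination_sq {E : Type*} [NormedAddCommGroup E] [InnerProductSpace ℝ E]
    (x y z : E) (t : ℝ) :
    ‖x - ((1 - t) • y + t • z)‖ ^ 2 =
      (1 - t) * ‖x - y‖ ^ 2 + t * ‖x - z‖ ^ 2 - t * (1 - t) * ‖y - z‖ ^ 2 := by
  have h₁ : x - ((1 - t) • y + t • z) = (1 - t) • (x - y) + t • (x - z) := by module
  have h₂ : y - z = (x - z) - (x - y) := by abel
  rw [h₁, h₂, norm_add_sq_real, norm_sub_sq_real (x - z), norm_smul, norm_smul,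
    inner_smul_left, inner_smul_right, mul_pow, mul_pow, Real.norm_eq_abs, Real.norm_eq_abs,
    sq_abs, sq_abs, real_inner_comm (x - y)]
  simp only [conj_trivial]
  ring

section Convex

variable {E : Type*} [NormedAddCommGroup E] [InnerProductSpace ℝ E] {K : Set E}

/-- The contraction of a convex set towards one of its points `z`, with ratio `1 - t`. -/
def Convex.contraction (hK : Convex ℝ K) (z : K) (t : ℝ) (ht₀ : 0 ≤ t) (ht₁ : t ≤ 1) (y : K) : K :=
  ⟨(1 - t) • (y : E) + t • (z : E),
    hK y.2 z.2 (sub_nonneg.2 ht₁) ht₀ (sub_add_cancel 1 t)⟩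

lemma Convex.continuous_contraction (hK : Convex ℝ K) (z : K) (t : ℝ) (ht₀ : 0 ≤ t)
    (ht₁ : t ≤ 1) : Continuous (hK.contraction z t ht₀ ht₁) := by
  unfold Convex.contraction
  fun_prop

lemma Convex.dist_contraction_sq (hK : Convex ℝ K) (x y z : K) (t : ℝ) (ht₀ : 0 ≤ t)
    (ht₁ : t ≤ 1) :
    dist x (hK.contraction z t ht₀ ht₁ y) ^ 2 =
      (1 - t) * dist x y ^ 2 + t * dist x z ^ 2 - t * (1 - t) * dist y z ^ 2 := by
  simp only [Subtype.dist_eq, dist_eq_norm, Convex.contraction, norm_sub_convexCombination_sq]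

variable [MeasurableSpace E] [BorelSpace E] [CompactSpace K]

/-- Contracting the second measure towards `z`: the strong convexity of the squared
Wasserstein distance along this interpolation. -/
lemma W2sq_map_contraction_le (hK : Convex ℝ K) (z : K) (t : ℝ) (ht₀ : 0 ≤ t) (ht₁ : t ≤ 1)
    (μ ν : Measure K) [IsProbabilityMeasure μ] [IsProbabilityMeasure ν] :
    W2sq μ (ν.map (hK.contraction z t ht₀ ht₁)) ≤
      (1 - t) * W2sq μ ν + t * ∫ x, dist x z ^ 2 ∂μ - t * (1 - t) * ∫ y, dist y z ^ 2 ∂ν := by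
  have hS := hK.continuous_contraction z t ht₀ ht₁
  set S := hK.contraction z t ht₀ ht₁ with hSdef
  refine le_of_forall_pos_le_add fun ε hε => ?_
  obtain ⟨γ, ⟨h₁, h₂⟩, hlt⟩ := exists_transportCost_lt (lt_add_of_pos_right (W2sq μ ν) hε)
  have : IsProbabilityMeasure γ := isProbabilityMeasure_of_map_fst h₁
  have hT : Continuous fun p : K × K => (p.1, S p.2) := by fun_prop
  have hd : Continuous fun p : K × K => dist p.1 p.2 ^ 2 := by fun_prop
  have hz : Continuous fun x : K => dist x z ^ 2 := by fun_prop
  have hcost : transportCost (γ.map fun p => (p.1, S p.2)) =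
      (1 - t) * transportCost γ + t * ∫ x, dist x z ^ 2 ∂μ
        - t * (1 - t) * ∫ y, dist y z ^ 2 ∂ν := by
    unfold transportCost
    rw [integral_map hT.measurable.aemeasurable hd.aestronglyMeasurable, ← h₁, ← h₂,
      integral_map measurable_fst.aemeasurable hz.aestronglyMeasurable,
      integral_map measurable_snd.aemeasurable hz.aestronglyMeasurable]
    have i₁ := hd.integrable_of_compactSpace γ
    have i₂ := (hz.comp continuous_fst).integrable_of_compactSpace γ
    have i₃ := (hz.comp continuous_snd).integrable_of_compactSpace γ
    simp only [Function.comp_def] at i₂ i₃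
    simp only [hSdef, hK.dist_contraction_sq]
    exact integral_linearCombination i₁ i₂ i₃ _ _ _
  have hle := W2sq_le (μ := μ) (ν := ν.map S) (γ := γ.map fun p => (p.1, S p.2))
    (by rw [Measure.map_map measurable_fst hT.measurable, ← h₁]; rfl)
    (by rw [Measure.map_map measurable_snd hT.measurable, ← h₂,
          Measure.map_map hS.measurable measurable_snd]; rfl)
  rw [hcost] at hle
  nlinarith [mul_le_mul_of_nonneg_left hlt.le (sub_nonneg.2 ht₁)]

end Convex

/-- Variance comparison between Wasserstein and linear barycenters: for `K ⊂ ℝⁿ` compact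
convex, `Ω` a probability measure on `P(K)` with `W₂`-barycenter `μ̄` and linear barycenter
`BC^L(Ω)` (the mixture `A ↦ ∫ μ(A) dΩ(μ)`), one has `Var(μ̄) ≤ Var(BC^L(Ω))`. -/
theorem variance_wasserstein_le_linear_barycenter (n : ℕ) (K : Set (EuclideanSpace ℝ (Fin n)))
    (hKc : IsCompact K) (hKconv : Convex ℝ K) (hKne : K.Nonempty)
    [MeasurableSpace (ProbabilityMeasure K)] [BorelSpace (ProbabilityMeasure K)]
    (Ω : Measure (ProbabilityMeasure K)) [IsProbabilityMeasure Ω]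
    (μb : ProbabilityMeasure K)
    (hbc : ∀ ν : ProbabilityMeasure K,
      ∫ μ, W2sq (μ : Measure K) (μb : Measure K) ∂Ω ≤
      ∫ μ, W2sq (μ : Measure K) (ν : Measure K) ∂Ω)
    (νL : Measure K)
    (hνL : ∀ A : Set K, MeasurableSet A → νL A = ∫⁻ μ, (μ : Measure K) A ∂Ω) :
    var (μb : Measure K) ≤ var νL := by
  have : CompactSpace K := isCompact_iff_compactSpace.1 hKc
  have : Nonempty K := hKne.to_subtype
  refine ciInf_mono ⟨0, ?_⟩ fun z => ?_
  · rintro _ ⟨y, rfl⟩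
    exact integral_nonneg fun _ => sq_nonneg _
  have hz : Continuous fun x : K => dist x z ^ 2 := by fun_prop
  rw [integral_eq_integral_integral_of_mixture Ω νL hνL hz fun _ => sq_nonneg _]
  have hcont : Continuous fun μ : ProbabilityMeasure K => ∫ x, dist x z ^ 2 ∂(μ : Measure K) :=
    ProbabilityMeasure.continuous_integral_continuousMap (⟨_, hz⟩ : C(K, ℝ))
  have hA := hcont.integrable_of_compactSpace Ω
  have hI := integrable_W2sq Ω μb
  set A := ∫ μ : ProbabilityMeasure K, ∫ x, dist x z ^ 2 ∂(μ : Measure K) ∂Ω with hAdef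
  set B := ∫ y, dist y z ^ 2 ∂(μb : Measure K) with hBdef
  have hI0 : 0 ≤ ∫ μ, W2sq (μ : Measure K) (μb : Measure K) ∂Ω :=
    integral_nonneg fun _ => W2sq_nonneg _ _
  have key : ∀ t : ℝ, 0 < t → t ≤ 1 → (1 - t) * B ≤ A := by
    intro t ht₀ ht₁
    have hS := hKconv.continuous_contraction z t ht₀.le ht₁
    have hmono := integral_mono (integrable_W2sq Ω (μb.map hS.measurable.aemeasurable))
      (((hI.const_mul (1 - t)).add (hA.const_mul t)).sub
        ((integrable_const B).const_mul (t * (1 - t))))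
      fun μ => W2sq_map_contraction_le hKconv z t ht₀.le ht₁ (μ : Measure K) (μb : Measure K)
    have hle := (hbc _).trans hmono
    simp only [Pi.add_apply, Pi.sub_apply] at hle
    rw [integral_linearCombination hI hA (integrable_const B),
      integral_const, probReal_univ, one_smul, ← hAdef] at hle
    have : t * ((1 - t) * B) ≤ t * A := by
      nlinarith [mul_nonneg ht₀.le hI0]
    exact le_of_mul_le_mul_left this ht₀
  have hlim : Tendsto (fun t : ℝ => (1 - t) * B) (𝓝[>] 0) (𝓝 B) := by
    have : Continuous fun t : ℝ => (1 - t) * B := by fun_prop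
    simpa using (this.tendsto 0).mono_left nhdsWithin_le_nhds
  refine le_of_tendsto hlim ?_
  filter_upwards [Ioc_mem_nhdsGT (zero_lt_one' ℝ)] with t ht
  exact key t ht.1 ht.2
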